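/- Completeness of the DAM compilation in abstract form: if an action model 𝒜 solves the learning task (for each trace i there is a valid 𝒜-plan from Iᵢ to a state containing Gᵢ), then there exists a single interleaved plan that, executed on the disjoint union of the m trace state spaces, maps the combined initial state ⋃ᵢ {(i, f) : f ∈ Iᵢ} to a state containing ⋃ᵢ {(i, f) : f ∈ Gᵢ}. -/

import Mathlib

structure Act (F : Type*) where
  pre : Set F
  add : Set F
  del : Set F

def applyA {F : Type*} (s : Set F) (a : Act F) : Set F := (s \ a.del) ∪ a.add

def run {F : Type*} (s : Set F) : List (Act F) → Set F
  | [] => s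
  | a :: π => run (applyA s a) π

def applicableSeq {F : Type*} (s : Set F) : List (Act F) → Prop
  | [] => True
  | a :: π => a.pre ⊆ s ∧ applicableSeq (applyA s a) π

/-- Lift an action of trace `i` to the disjoint union of the `m` trace state
spaces: it acts only on fluents tagged with `i`. -/
def lift {F : Type*} {m : ℕ} (i : Fin m) (a : Act F) : Act (Fin m × F) :=
  ⟨(fun f => (i, f)) '' a.pre, (fun f => (i, f)) '' a.add, (fun f => (i, f)) '' a.del⟩

def comb {F : Type*} {m : ℕ} (S : Fin m → Set F) : Set (Fin m × F) := {x | x.2 ∈ S x.1}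

/-- The actions of an interleaved plan that belong to trace `i`. -/
def proj {F : Type*} {m : ℕ} (i : Fin m) (p : List (Fin m × Act F)) : List (Act F) :=
  (p.filter (fun q => q.1 = i)).map Prod.snd

theorem comb_apply {F : Type*} {m : ℕ} (S : Fin m → Set F) (i : Fin m) (a : Act F) :
    applyA (comb S) (lift i a) = comb (Function.update S i (applyA (S i) a)) := by
  ext ⟨j, f⟩
  by_cases h : j = i
  · subst h
    simp [comb, applyA, lift]
  · have h' : ¬ i = j := fun e => h e.symm
    simp [comb, applyA, lift, h, h']

theorem comb_plan {F : Type*} {m : ℕ} (p : List (Fin m × Act F)) :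
    ∀ S : Fin m → Set F, (∀ i, applicableSeq (S i) (proj i p)) →
      applicableSeq (comb S) (p.map (fun q => lift q.1 q.2)) ∧
      run (comb S) (p.map (fun q => lift q.1 q.2)) = comb (fun i => run (S i) (proj i p)) := by
  induction p with
  | nil =>
    intro S _
    simp [applicableSeq, run, proj]
  | cons q p ih =>
    obtain ⟨j, a⟩ := q
    intro S hS
    have hj : proj j ((j, a) :: p) = a :: proj j p := by simp [proj]
    have hn : ∀ i, i ≠ j → proj i ((j, a) :: p) = proj i p := by
      intro i hi
      simp [proj, hi.symm]
    have h1 := hS j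
    rw [hj] at h1
    obtain ⟨hpre, h2⟩ := h1
    obtain ⟨ha, hr⟩ := ih (Function.update S j (applyA (S j) a)) (by
      intro i
      by_cases hi : i = j
      · subst hi
        simpa using h2
      · have := hS i
        rw [hn i hi] at this
        simpa [hi] using this)
    refine ⟨⟨?_, ?_⟩, ?_⟩
    · rintro _ ⟨f, hf, rfl⟩
      exact hpre hf
    · rw [comb_apply]
      exact ha
    · simp only [List.map_cons, run]
      rw [comb_apply, hr]
      congr 1
      funext i
      by_cases hi : i = j
      · subst hi
        simp [hj, run]
      · simp [hn i hi, hi]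

theorem exists_plan {F : Type*} {m : ℕ} (𝒜 : Set (Act F)) (σ : Fin m → List (Act F))
    (h : ∀ i, ∀ a ∈ σ i, a ∈ 𝒜) (s : Finset (Fin m)) :
    ∃ p : List (Fin m × Act F), (∀ q ∈ p, q.2 ∈ 𝒜) ∧
      ∀ i, proj i p = if i ∈ s then σ i else [] := by
  induction s using Finset.induction_on with
  | empty => exact ⟨[], by simp, by simp [proj]⟩
  | insert j s hj ih =>
    obtain ⟨p, hp, hpr⟩ := ih
    refine ⟨(σ j).map (fun a => (j, a)) ++ p, ?_, ?_⟩
    · intro q hq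
      rcases List.mem_append.1 hq with hq | hq
      · obtain ⟨a, ha, rfl⟩ := List.mem_map.1 hq
        exact h j a ha
      · exact hp q hq
    · intro i
      have e : proj i ((σ j).map (fun a => (j, a)) ++ p)
          = proj i ((σ j).map (fun a => (j, a))) ++ proj i p := by simp [proj]
      rw [e, hpr i]
      by_cases hi : i = j
      · subst hi
        simp [hj, proj, List.filter_map, Function.comp_def]
      · have hi' : ¬ j = i := fun e => hi e.symm
        simp [hi, hi', proj, List.filter_map, Function.comp_def]

/-- Completeness of the DAM compilation (abstract form): if the model 𝒜 solves
every trace separately, then there is a single interleaved plan on the disjoint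
union of the trace state spaces mapping the combined initial state to a state
containing the combined goal. -/
theorem dam_completeness {F : Type*} (m : ℕ) (𝒜 : Set (Act F))
    (I G : Fin m → Set F)
    (hsolve : ∀ i, ∃ σ : List (Act F), (∀ a ∈ σ, a ∈ 𝒜) ∧
      applicableSeq (I i) σ ∧ G i ⊆ run (I i) σ) :
    ∃ plan : List (Fin m × Act F), (∀ p ∈ plan, p.2 ∈ 𝒜) ∧
      applicableSeq {x : Fin m × F | x.2 ∈ I x.1} (plan.map (fun p => lift p.1 p.2)) ∧
      {x : Fin m × F | x.2 ∈ G x.1} ⊆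
        run {x : Fin m × F | x.2 ∈ I x.1} (plan.map (fun p => lift p.1 p.2)) := by
  choose σ h𝒜 happ hG using hsolve
  obtain ⟨p, hp, hpr⟩ := exists_plan 𝒜 σ h𝒜 Finset.univ
  simp only [Finset.mem_univ, if_true] at hpr
  obtain ⟨ha, hr⟩ := comb_plan p I (fun i => by rw [hpr i]; exact happ i)
  refine ⟨p, hp, ha, ?_⟩
  change _ ⊆ run (comb I) _
  rw [hr]
  rintro ⟨i, f⟩ hf
  change f ∈ run (I i) (proj i p)
  rw [hpr i]
  exact hG i hf
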